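/- arXiv:2001.06412 — 6 statements merged into one kernel-verified Lean document; each statement's English description precedes it below -/
import Mathlib

section
/- Let H ∈ (1/2, 1) and let real numbers satisfy 0 ≤ u < v ≤ s < t. Then (t+u)^{2H} + (t−u)^{2H} + (s+v)^{2H} + (s−v)^{2H} − (t+v)^{2H} − (t−v)^{2H} − (s+u)^{2H} − (s−u)^{2H} > 0. (This expresses that the increments of a sub-fractional Brownian motion over non-overlapping intervals are positively correlated when H > 1/2.) -/
/-- Strict concavity of `y ↦ y ^ q` for `0 < q < 1`: spreading two points symmetrically about
their midpoint strictly decreases the sum of their powers. -/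
theorem rpow_add_rpow_lt_of_symm_spread {q x u v : ℝ} (hq₀ : 0 < q) (hq₁ : q < 1)
    (hu : 0 ≤ u) (huv : u < v) (hvx : v ≤ x) :
    (x + v) ^ q + (x - v) ^ q < (x + u) ^ q + (x - u) ^ q := by
  have hv : 0 < v := hu.trans_lt huv
  have hc := (Real.strictConcaveOn_rpow hq₀ hq₁).2
    (show x + v ∈ Set.Ici (0 : ℝ) from Set.mem_Ici.2 (by linarith))
    (show x - v ∈ Set.Ici (0 : ℝ) from Set.mem_Ici.2 (by linarith))
    (by linarith : x + v ≠ x - v)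
  have ha : 0 < (v + u) / (2 * v) := by positivity
  have hb : 0 < (v - u) / (2 * v) := div_pos (by linarith) (by linarith)
  have hab : (v + u) / (2 * v) + (v - u) / (2 * v) = 1 := by field_simp; ring
  have h₁ := hc ha hb hab
  have h₂ := hc hb ha (by linarith)
  have e₁ : (v + u) / (2 * v) * (x + v) + (v - u) / (2 * v) * (x - v) = x + u := by
    field_simp; ring
  have e₂ : (v - u) / (2 * v) * (x + v) + (v + u) / (2 * v) * (x - v) = x - u := by
    field_simp; ring
  simp only [smul_eq_mul] at h₁ h₂
  rw [e₁] at h₁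
  rw [e₂] at h₂
  rw [← eq_sub_iff_add_eq] at hab
  rw [hab] at h₁ h₂
  linarith

/-- For `1 < p < 2` and `0 ≤ u < v`, the difference of symmetric sums of `p`-th powers is strictly
increasing on `[v, ∞)`. -/
theorem strictMonoOn_symm_rpow_sub {p u v : ℝ} (hp₁ : 1 < p) (hp₂ : p < 2)
    (hu : 0 ≤ u) (huv : u < v) :
    StrictMonoOn (fun x : ℝ ↦ (x + u) ^ p + (x - u) ^ p - (x + v) ^ p - (x - v) ^ p)
      (Set.Ici v) := by
  have hadd (x c : ℝ) : HasDerivAt (fun y : ℝ ↦ (y + c) ^ p) (1 * p * (x + c) ^ (p - 1)) x :=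
    ((hasDerivAt_id x).add_const c).rpow_const (Or.inr hp₁.le)
  have hsub (x c : ℝ) : HasDerivAt (fun y : ℝ ↦ (y - c) ^ p) (1 * p * (x - c) ^ (p - 1)) x :=
    ((hasDerivAt_id x).sub_const c).rpow_const (Or.inr hp₁.le)
  have hd (x : ℝ) := (((hadd x u).add (hsub x u)).sub (hadd x v)).sub (hsub x v)
  refine strictMonoOn_of_deriv_pos (convex_Ici v)
    (fun x _ ↦ (hd x).continuousAt.continuousWithinAt) fun x hx ↦ ?_
  rw [interior_Ici, Set.mem_Ioi] at hx
  have hlt := rpow_add_rpow_lt_of_symm_spread (q := p - 1) (by linarith) (by linarith)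
    hu huv hx.le
  refine (hd x).deriv.symm ▸ ?_
  nlinarith

/-- For `H > 1/2`, the increments of a sub-fractional Brownian motion over
non-overlapping intervals are positively correlated. -/
theorem sfBm_increments_positively_correlated
    (H u v s t : ℝ) (hH : H ∈ Set.Ioo (1 / 2 : ℝ) 1)
    (hu : 0 ≤ u) (huv : u < v) (hvs : v ≤ s) (hst : s < t) :
    0 < (t + u) ^ (2 * H) + (t - u) ^ (2 * H) + (s + v) ^ (2 * H) + (s - v) ^ (2 * H)
      - (t + v) ^ (2 * H) - (t - v) ^ (2 * H) - (s + u) ^ (2 * H) - (s - u) ^ (2 * H) := by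
  have h := strictMonoOn_symm_rpow_sub (p := 2 * H) (by linarith [hH.1]) (by linarith [hH.2])
    hu huv (Set.mem_Ici.2 hvs) (Set.mem_Ici.2 (hvs.trans hst.le)) hst
  dsimp only at h
  linarith
end

section
/- Let H ∈ (0, 1/2) and let real numbers satisfy 0 ≤ u < v ≤ s < t. Then (t+u)^{2H} + (t−u)^{2H} + (s+v)^{2H} + (s−v)^{2H} − (t+v)^{2H} − (t−v)^{2H} − (s+u)^{2H} − (s−u)^{2H} < 0. (This expresses that the increments of a sub-fractional Brownian motion over non-overlapping intervals are negatively correlated when H < 1/2.) -/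
theorem Real.strictConvexOn_rpow_of_neg {q : ℝ} (hq : q < 0) :
    StrictConvexOn ℝ (Set.Ioi 0) fun x : ℝ => x ^ q := by
  refine ⟨convex_Ioi 0, fun x hx y hy hxy a b ha hb hab => ?_⟩
  have hz : 0 < a • x + b • y := convex_Ioi (0 : ℝ) hx hy ha.le hb.le hab
  have hlog := strictConcaveOn_log_Ioi.2 hx hy hxy ha hb hab
  have hexp := convexOn_exp.2 (Set.mem_univ (Real.log x * q)) (Set.mem_univ (Real.log y * q))
    ha.le hb.le hab
  dsimp only
  rw [Real.rpow_def_of_pos hx, Real.rpow_def_of_pos hy, Real.rpow_def_of_pos hz]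
  refine (Real.exp_lt_exp.2 ?_).trans_le hexp
  simp only [smul_eq_mul] at hlog ⊢
  nlinarith

/-- Moving two points symmetrically towards their midpoint
strictly decreases the sum of the values of a negative power. -/
theorem Real.rpow_add_add_rpow_sub_lt_of_neg {q u v x : ℝ} (hq : q < 0) (hu : 0 ≤ u) (huv : u < v)
    (hvx : v < x) :
    (x + u) ^ q + (x - u) ^ q < (x + v) ^ q + (x - v) ^ q := by
  have hv : 0 < v := hu.trans_lt huv
  have hconv := Real.strictConvexOn_rpow_of_neg hq
  have hmem₁ : x + v ∈ Set.Ioi (0 : ℝ) := Set.mem_Ioi.2 (by linarith)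
  have hmem₂ : x - v ∈ Set.Ioi (0 : ℝ) := Set.mem_Ioi.2 (by linarith)
  have hne : x + v ≠ x - v := by linarith
  have ha : 0 < (v + u) / (2 * v) := by positivity
  have hb : 0 < (v - u) / (2 * v) := div_pos (by linarith) (by linarith)
  have hab : (v + u) / (2 * v) + (v - u) / (2 * v) = 1 := by field_simp; ring
  have h₁ := hconv.2 hmem₁ hmem₂ hne ha hb hab
  have h₂ := hconv.2 hmem₁ hmem₂ hne hb ha (by rw [add_comm, hab])
  simp only [smul_eq_mul] at h₁ h₂
  have e₁ : (v + u) / (2 * v) * (x + v) + (v - u) / (2 * v) * (x - v) = x + u := by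
    field_simp; ring
  have e₂ : (v - u) / (2 * v) * (x + v) + (v + u) / (2 * v) * (x - v) = x - u := by
    field_simp; ring
  rw [e₁] at h₁
  rw [e₂] at h₂
  calc (x + u) ^ q + (x - u) ^ q
      < _ := add_lt_add h₁ h₂
    _ = ((v + u) / (2 * v) + (v - u) / (2 * v)) * ((x + v) ^ q + (x - v) ^ q) := by ring
    _ = (x + v) ^ q + (x - v) ^ q := by rw [hab, one_mul]

theorem Real.strictAntiOn_rpow_spread_sub {p u v : ℝ} (hp₀ : 0 < p) (hp₁ : p < 1) (hu : 0 ≤ u)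
    (huv : u < v) :
    StrictAntiOn (fun x : ℝ => (x + u) ^ p + (x - u) ^ p - ((x + v) ^ p + (x - v) ^ p))
      (Set.Ici v) := by
  refine strictAntiOn_of_deriv_neg (convex_Ici v) ?_ fun x hx => ?_
  · have hc : ∀ c : ℝ, Continuous fun x : ℝ => (x + c) ^ p := fun c =>
      (continuous_id.add continuous_const).rpow_const fun _ => Or.inr hp₀.le
    simp only [sub_eq_add_neg _ u, sub_eq_add_neg _ v]
    exact (((hc u).add (hc (-u))).sub ((hc v).add (hc (-v)))).continuousOn
  · rw [interior_Ici, Set.mem_Ioi] at hx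
    have hd : ∀ c : ℝ, x + c ≠ 0 →
        HasDerivAt (fun y : ℝ => (y + c) ^ p) (1 * p * (x + c) ^ (p - 1)) x := fun c hc =>
      ((hasDerivAt_id x).add_const c).rpow_const (Or.inl hc)
    have hderiv := ((hd u (by linarith)).add (hd (-u) (by linarith))).sub
      ((hd v (by linarith)).add (hd (-v) (by linarith)))
    simp only [← sub_eq_add_neg] at hderiv
    have hlt := Real.rpow_add_add_rpow_sub_lt_of_neg (sub_neg.2 hp₁) hu huv hx
    refine (HasDerivAt.deriv hderiv).trans_lt ?_
    nlinarith


/-- For `H < 1/2`, the increments of a sub-fractional Brownian motion over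
non-overlapping intervals are negatively correlated. -/
theorem sfBm_increments_negatively_correlated
    (H u v s t : ℝ) (hH : H ∈ Set.Ioo (0 : ℝ) (1 / 2))
    (hu : 0 ≤ u) (huv : u < v) (hvs : v ≤ s) (hst : s < t) :
    (t + u) ^ (2 * H) + (t - u) ^ (2 * H) + (s + v) ^ (2 * H) + (s - v) ^ (2 * H)
      - (t + v) ^ (2 * H) - (t - v) ^ (2 * H) - (s + u) ^ (2 * H) - (s - u) ^ (2 * H) < 0 := by
  have hlt := Real.strictAntiOn_rpow_spread_sub (p := 2 * H) (by linarith [hH.1])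
    (by linarith [hH.2]) hu huv (Set.mem_Ici.2 hvs) (Set.mem_Ici.2 (hvs.trans hst.le)) hst
  dsimp only at hlt
  linarith
end

section
/- Let H ∈ (1/2, 1) and 0 ≤ u < v. Then the function x ↦ (x+v)^{2H} + (x−v)^{2H} − (x+u)^{2H} − (x−u)^{2H} is strictly antitone (strictly decreasing) on the interval [v, ∞). -/
/-- A strictly concave function takes a strictly larger sum at the inner pair of points
`x - u, x + u` than at the outer pair `x - v, x + v`. -/
lemma StrictConcaveOn.add_lt_add_of_symm {s : Set ℝ} {f : ℝ → ℝ} (hf : StrictConcaveOn ℝ s f)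
    {x u v : ℝ} (hu : 0 ≤ u) (huv : u < v) (hl : x - v ∈ s) (hr : x + v ∈ s) :
    f (x + v) + f (x - v) < f (x + u) + f (x - u) := by
  have hv : 0 < v := hu.trans_lt huv
  have hne : x - v ≠ x + v := by linarith
  have ha : 0 < (v + u) / (2 * v) := by positivity
  have hb : 0 < (v - u) / (2 * v) := div_pos (by linarith) (by linarith)
  have hab : (v + u) / (2 * v) + (v - u) / (2 * v) = 1 := by field_simp; ring
  have h₁ := hf.2 hl hr hne ha hb hab
  have h₂ := hf.2 hl hr hne hb ha ((add_comm _ _).trans hab)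
  simp only [smul_eq_mul] at h₁ h₂
  rw [show (v + u) / (2 * v) * (x - v) + (v - u) / (2 * v) * (x + v) = x - u by
    field_simp; ring] at h₁
  rw [show (v - u) / (2 * v) * (x - v) + (v + u) / (2 * v) * (x + v) = x + u by
    field_simp; ring] at h₂
  linear_combination h₁ + h₂ - (f (x + v) + f (x - v)) * hab

/-- For `H ∈ (1/2, 1)` and `0 ≤ u < v`, the map
`x ↦ (x+v)^{2H} + (x−v)^{2H} − (x+u)^{2H} − (x−u)^{2H}` is strictly decreasing on `[v, ∞)`. -/
theorem sfBm_key_map_strictAntiOn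
    (H u v : ℝ) (hH : H ∈ Set.Ioo (1 / 2 : ℝ) 1) (hu : 0 ≤ u) (huv : u < v) :
    StrictAntiOn
      (fun x : ℝ => (x + v) ^ (2 * H) + (x - v) ^ (2 * H)
        - (x + u) ^ (2 * H) - (x - u) ^ (2 * H))
      (Set.Ici v) := by
  obtain ⟨hH₁, hH₂⟩ := hH
  have hadd (c x : ℝ) : HasDerivAt (fun y : ℝ => (y + c) ^ (2 * H))
      (1 * (2 * H) * (x + c) ^ (2 * H - 1)) x :=
    ((hasDerivAt_id x).add_const c).rpow_const (Or.inr (by linarith))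
  have hsub (c x : ℝ) : HasDerivAt (fun y : ℝ => (y - c) ^ (2 * H))
      (1 * (2 * H) * (x - c) ^ (2 * H - 1)) x :=
    ((hasDerivAt_id x).sub_const c).rpow_const (Or.inr (by linarith))
  have hderiv (x : ℝ) := (((hadd v x).add (hsub v x)).sub (hadd u x)).sub (hsub u x)
  refine strictAntiOn_of_deriv_neg (convex_Ici v)
    (fun x _ => (hderiv x).continuousAt.continuousWithinAt) fun x hx => ?_
  rw [interior_Ici, Set.mem_Ioi] at hx
  refine (hderiv x).deriv.trans_lt ?_
  have hconc := (Real.strictConcaveOn_rpow (p := 2 * H - 1) (by linarith)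
    (by linarith)).add_lt_add_of_symm (x := x) hu huv
    (Set.mem_Ici.2 (by linarith)) (Set.mem_Ici.2 (by linarith))
  have hmul := mul_lt_mul_of_pos_left hconc (show 0 < 2 * H by linarith)
  linarith
end

section
/- Define g_H(s,t) = −2^{2H−1}(s^{2H} + t^{2H}) + (s+t)^{2H} + (t−s)^{2H} for 0 ≤ s ≤ t (the increment variance E[(ξ_t^H − ξ_s^H)²] of a sub-fractional Brownian motion). If H ∈ (0,1) with H ≠ 1/2, then for all 0 ≤ s < t and all u > 0 one has g_H(s+u, t+u) ≠ g_H(s,t); that is, the increments of the sub-fractional Brownian motion are non-stationary. -/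
/-- The increment variance `E[(ξ_t^H − ξ_s^H)²]` of a sub-fractional Brownian motion. -/
noncomputable def sfBmIncVar (H s t : ℝ) : ℝ :=
  -(2 : ℝ) ^ (2 * H - 1) * (s ^ (2 * H) + t ^ (2 * H)) + (s + t) ^ (2 * H) + (t - s) ^ (2 * H)

/-- Strict midpoint concavity of `x ↦ x ^ r` for `0 < r < 1`. -/
theorem rpow_add_rpow_lt_two_mul_midpoint_rpow {r p q : ℝ} (hr0 : 0 < r) (hr1 : r < 1)
    (hp : 0 < p) (hpq : p < q) : p ^ r + q ^ r < 2 * ((p + q) / 2) ^ r := by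
  obtain ⟨-, hconc⟩ := Real.strictConcaveOn_rpow hr0 hr1
  have h := hconc (Set.mem_Ici.2 hp.le)
    (Set.mem_Ici.2 (hp.trans hpq).le) hpq.ne (half_pos one_pos) (half_pos one_pos) (add_halves 1)
  simp only [smul_eq_mul] at h
  rw [show 1 / 2 * p + 1 / 2 * q = (p + q) / 2 by ring] at h
  linarith

/-- Strict midpoint convexity of `x ↦ x ^ r` for `-1 < r < 0`. -/
theorem two_mul_midpoint_rpow_lt_rpow_add_rpow {r p q : ℝ} (hr0 : r < 0) (hr1 : -1 < r)
    (hp : 0 < p) (hpq : p < q) : 2 * ((p + q) / 2) ^ r < p ^ r + q ^ r := by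
  have hq := hp.trans hpq
  have hm : 0 < (p + q) / 2 := by positivity
  have h := rpow_add_rpow_lt_two_mul_midpoint_rpow (neg_pos.2 hr0) (neg_lt.1 hr1) hp hpq
  have hinv : ∀ x : ℝ, 0 < x → x ^ r = (x ^ (-r))⁻¹ := fun x hx => by
    rw [Real.rpow_neg hx.le, inv_inv]
  rw [hinv _ hp, hinv _ hq, hinv _ hm]
  have hA : 0 < p ^ (-r) := by positivity
  have hB : 0 < q ^ (-r) := by positivity
  generalize p ^ (-r) = A at *
  generalize q ^ (-r) = B at *
  generalize ((p + q) / 2) ^ (-r) = M at *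
  calc 2 * M⁻¹ < 2 * ((A + B) / 2)⁻¹ := by gcongr; linarith
    _ ≤ A⁻¹ + B⁻¹ := by
      rw [← sub_nonneg]
      have : A⁻¹ + B⁻¹ - 2 * ((A + B) / 2)⁻¹ = (A - B) ^ 2 / (A * B * (A + B)) := by
        field_simp
        ring
      rw [this]
      positivity

theorem continuous_sfBmIncVar_shift {H : ℝ} (hH : 0 < H) (s t : ℝ) :
    Continuous fun x => sfBmIncVar H (s + x) (t + x) := by
  have hH2 : 0 ≤ 2 * H := by positivity
  unfold sfBmIncVar
  have key : ∀ f : ℝ → ℝ, Continuous f → Continuous fun x => f x ^ (2 * H) :=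
    fun f hf => hf.rpow_const fun _ => Or.inr hH2
  exact ((continuous_const.mul ((key _ (by fun_prop)).add (key _ (by fun_prop)))).add
    (key _ (by fun_prop))).add (key _ (by fun_prop))

theorem hasDerivAt_sfBmIncVar_shift (H : ℝ) {s t x : ℝ} (hs : 0 < s + x) (hst : s < t) :
    HasDerivAt (fun x => sfBmIncVar H (s + x) (t + x))
      (2 ^ (2 * H) * H * (2 * (((s + x) + (t + x)) / 2) ^ (2 * H - 1)
        - ((s + x) ^ (2 * H - 1) + (t + x) ^ (2 * H - 1)))) x := by
  have ht : 0 < t + x := by linarith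
  have hp := ((hasDerivAt_id x).const_add s).rpow_const (p := 2 * H) (Or.inl hs.ne')
  have hq := ((hasDerivAt_id x).const_add t).rpow_const (p := 2 * H) (Or.inl ht.ne')
  have hpq := (((hasDerivAt_id x).const_add s).add ((hasDerivAt_id x).const_add t)).rpow_const
    (p := 2 * H) (Or.inl (add_pos hs ht).ne')
  have h := (((hp.add hq).const_mul (-(2 : ℝ) ^ (2 * H - 1))).add hpq).add_const
    ((t - s) ^ (2 * H))
  refine (h.congr_of_eventuallyEq (.of_forall fun y => by simp [sfBmIncVar])).congr_deriv ?_
  have h2 : (2 : ℝ) ^ (2 * H) = 2 * 2 ^ (2 * H - 1) := by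
    rw [Real.rpow_sub_one two_ne_zero]; ring
  simp only [id, Pi.add_apply]
  rw [Real.div_rpow (add_pos hs ht).le zero_le_two, h2]
  field_simp
  ring

/-- For `H ≠ 1/2`, the increments of a sub-fractional Brownian motion are non-stationary. -/
theorem sfBm_increments_nonstationary
    (H : ℝ) (hH : H ∈ Set.Ioo (0 : ℝ) 1) (hH' : H ≠ 1 / 2) :
    ∀ s t u : ℝ, 0 ≤ s → s < t → 0 < u →
      sfBmIncVar H (s + u) (t + u) ≠ sfBmIncVar H s t := by
  intro s t u hs hst hu
  obtain ⟨hH0, hH1⟩ := hH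
  have hcont := (continuous_sfBmIncVar_shift hH0 s t).continuousOn (s := Set.Ici 0)
  have hc : 0 < (2 : ℝ) ^ (2 * H) * H := by positivity
  rcases lt_or_gt_of_ne hH' with h | h
  · have hanti := strictAntiOn_of_deriv_neg (convex_Ici 0) hcont fun x hx => by
      rw [interior_Ici, Set.mem_Ioi] at hx
      rw [(hasDerivAt_sfBmIncVar_shift H (by linarith) hst).deriv]
      exact mul_neg_of_pos_of_neg hc (sub_neg.2 (two_mul_midpoint_rpow_lt_rpow_add_rpow
        (by linarith) (by linarith) (by linarith) (by linarith)))
    simpa using (hanti Set.self_mem_Ici (Set.mem_Ici.2 hu.le) hu).ne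
  · have hmono := strictMonoOn_of_deriv_pos (convex_Ici 0) hcont fun x hx => by
      rw [interior_Ici, Set.mem_Ioi] at hx
      rw [(hasDerivAt_sfBmIncVar_shift H (by linarith) hst).deriv]
      exact mul_pos hc (sub_pos.2 (rpow_add_rpow_lt_two_mul_midpoint_rpow
        (by linarith) (by linarith) (by linarith) (by linarith)))
    simpa using (hmono Set.self_mem_Ici (Set.mem_Ici.2 hu.le) hu).ne'
end

section
/- Let H ∈ (1/2, 1) and 0 ≤ s < t. Then the function u ↦ (s+t+2u)^{2H} − 2^{2H−1}((s+u)^{2H} + (t+u)^{2H}) is strictly monotone increasing on [0, ∞). Consequently, for g_H(s,t) = −2^{2H−1}(s^{2H} + t^{2H}) + (s+t)^{2H} + (t−s)^{2H}, the map u ↦ g_H(s+u, t+u) is strictly increasing on [0, ∞). -/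
/-- Strict midpoint concavity of `x ↦ x ^ q` for `0 < q < 1`, in homogeneous form. -/
theorem two_rpow_mul_add_rpow_lt {q a b : ℝ} (hq₀ : 0 < q) (hq₁ : q < 1) (ha : 0 ≤ a)
    (hb : 0 ≤ b) (hab : a ≠ b) : (2 : ℝ) ^ q * (a ^ q + b ^ q) < 2 * (a + b) ^ q := by
  have h := (Real.strictConcaveOn_rpow hq₀ hq₁).2 (Set.mem_Ici.2 ha) (Set.mem_Ici.2 hb) hab
    (by norm_num : (0 : ℝ) < 1 / 2) (by norm_num : (0 : ℝ) < 1 / 2) (by norm_num)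
  simp only [smul_eq_mul] at h
  have hsplit : (a + b) ^ q = (2 : ℝ) ^ q * (1 / 2 * a + 1 / 2 * b) ^ q := by
    rw [← Real.mul_rpow (by norm_num) (by positivity)]
    congr 1
    ring
  have h2 : (0 : ℝ) < 2 ^ q := by positivity
  rw [hsplit]
  nlinarith [mul_lt_mul_of_pos_left h h2]


/-- For `H ∈ (1/2, 1)`, the shifted increment variance of the sfBm is strictly increasing
in the shift. -/
theorem sfBm_shifted_increment_variance_strictMono
    (H s t : ℝ) (hH : H ∈ Set.Ioo (1 / 2 : ℝ) 1) (hs : 0 ≤ s) (hst : s < t) :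
    StrictMonoOn
      (fun u : ℝ => (s + t + 2 * u) ^ (2 * H)
        - (2 : ℝ) ^ (2 * H - 1) * ((s + u) ^ (2 * H) + (t + u) ^ (2 * H)))
      (Set.Ici (0 : ℝ)) ∧
    StrictMonoOn (fun u : ℝ => sfBmIncVar H (s + u) (t + u)) (Set.Ici (0 : ℝ)) := by
  obtain ⟨hH₀, hH₁⟩ := hH
  have hmono : StrictMonoOn
      (fun u : ℝ => (s + t + 2 * u) ^ (2 * H)
        - (2 : ℝ) ^ (2 * H - 1) * ((s + u) ^ (2 * H) + (t + u) ^ (2 * H)))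
      (Set.Ici (0 : ℝ)) := by
    have hderiv (u : ℝ) : HasDerivAt
        (fun u : ℝ => (s + t + 2 * u) ^ (2 * H)
          - (2 : ℝ) ^ (2 * H - 1) * ((s + u) ^ (2 * H) + (t + u) ^ (2 * H)))
        (2 * (2 * H) * (s + t + 2 * u) ^ (2 * H - 1) - (2 : ℝ) ^ (2 * H - 1) *
          (1 * (2 * H) * (s + u) ^ (2 * H - 1) + 1 * (2 * H) * (t + u) ^ (2 * H - 1))) u := by
      have hp : 1 ≤ 2 * H := by linarith
      have hsum : HasDerivAt (fun u : ℝ => s + t + 2 * u) 2 u := by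
        simpa using ((hasDerivAt_id u).const_mul 2).const_add (s + t)
      exact (hsum.rpow_const (.inr hp)).sub
        ((((hasDerivAt_id u).const_add s).rpow_const (.inr hp)).add
          (((hasDerivAt_id u).const_add t).rpow_const (.inr hp)) |>.const_mul _)
    refine strictMonoOn_of_deriv_pos (convex_Ici 0)
      (fun u _ => (hderiv u).continuousAt.continuousWithinAt) fun u hu => ?_
    rw [interior_Ici, Set.mem_Ioi] at hu
    rw [(hderiv u).deriv]
    have h := two_rpow_mul_add_rpow_lt (q := 2 * H - 1) (a := s + u) (b := t + u)
      (by linarith) (by linarith) (by linarith) (by linarith) (by simpa using hst.ne)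
    rw [show s + u + (t + u) = s + t + 2 * u by ring] at h
    nlinarith [mul_lt_mul_of_pos_left h (by linarith : 0 < 2 * H)]
  refine ⟨hmono, fun u hu v hv huv => ?_⟩
  have h := hmono hu hv huv
  simp only [sfBmIncVar, add_sub_add_right_eq_sub] at h ⊢
  rw [show s + u + (t + u) = s + t + 2 * u by ring, show s + v + (t + v) = s + t + 2 * v by ring]
  linarith
end

section
/- Let H ∈ (1/2, 1) and let real numbers satisfy 0 ≤ u < v ≤ s < t. Then (t+v)^{2H} + (s+u)^{2H} > (t+u)^{2H} + (s+v)^{2H}. Consequently the increment covariance of the sub-fractional Brownian motion, (1/2)[(t+u)^{2H} + (t−u)^{2H} + (s+v)^{2H} + (s−v)^{2H} − (t+v)^{2H} − (t−v)^{2H} − (s+u)^{2H} − (s−u)^{2H}], is strictly smaller than the increment covariance of the fractional Brownian motion with the same Hurst index, (1/2)[(t−u)^{2H} + (s−v)^{2H} − (t−v)^{2H} − (s−u)^{2H}]; i.e., the sfBm has more weakly correlated increments than the fBm when H > 1/2. -/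
/-- For a strictly convex function, moving two points apart while keeping their sum fixed
strictly increases the sum of the values. -/
theorem StrictConvexOn.add_lt_add_of_add_eq_add {S : Set ℝ} {f : ℝ → ℝ}
    (hf : StrictConvexOn ℝ S f) {a b x y : ℝ} (ha : a ∈ S) (hb : b ∈ S)
    (hax : a < x) (hay : a < y) (h : x + y = a + b) : f x + f y < f a + f b := by
  have hx := hf.secant_strict_mono_aux1 ha hb hax (by linarith)
  have hy := hf.secant_strict_mono_aux1 ha hb hay (by linarith)
  obtain rfl : y = a + b - x := by linarith
  refine lt_of_mul_lt_mul_left ?_ (show 0 ≤ b - a by linarith)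
  linarith

/-- For `H ∈ (1/2, 1)` and `0 ≤ u < v ≤ s < t` one has
`(t+v)^{2H} + (s+u)^{2H} > (t+u)^{2H} + (s+v)^{2H}`; consequently the increment
covariance of the sfBm is strictly smaller than that of the fBm with the same
Hurst index: the sfBm has more weakly correlated increments. -/
theorem sfBm_weaker_correlation_than_fBm
    (H u v s t : ℝ) (hH : H ∈ Set.Ioo (1 / 2 : ℝ) 1)
    (hu : 0 ≤ u) (huv : u < v) (hvs : v ≤ s) (hst : s < t) :
    (t + u) ^ (2 * H) + (s + v) ^ (2 * H) < (t + v) ^ (2 * H) + (s + u) ^ (2 * H) ∧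
    (1 / 2) * ((t + u) ^ (2 * H) + (t - u) ^ (2 * H) + (s + v) ^ (2 * H)
        + (s - v) ^ (2 * H) - (t + v) ^ (2 * H) - (t - v) ^ (2 * H)
        - (s + u) ^ (2 * H) - (s - u) ^ (2 * H))
      < (1 / 2) * ((t - u) ^ (2 * H) + (s - v) ^ (2 * H)
        - (t - v) ^ (2 * H) - (s - u) ^ (2 * H)) := by
  have key : (t + u) ^ (2 * H) + (s + v) ^ (2 * H) < (t + v) ^ (2 * H) + (s + u) ^ (2 * H) := by
    rw [add_comm ((t + v) ^ (2 * H))]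
    exact (strictConvexOn_rpow (p := 2 * H) (by linarith [hH.1])).add_lt_add_of_add_eq_add
      (Set.mem_Ici.2 (by linarith)) (Set.mem_Ici.2 (by linarith))
      (by linarith) (by linarith) (by ring)
  exact ⟨key, by linarith⟩
end
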